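/- Let R be a unitarily invariant matrix function on ℝ^{p₁×p₂}, R(B) = f(σ(B)) where σ(B) is the vector of singular values and f is absolutely symmetric, convex and differentiable. Then R is differentiable and ∇R(B) = U diag[∇f(σ)] Vᵀ, where B = U diag[σ] Vᵀ is a singular value decomposition of B. -/

import Mathlib

open Matrix
attribute [local instance] Matrix.normedAddCommGroup Matrix.normedSpace

/-- The rectangular "diagonal" `p₁ × p₂` matrix with diagonal entries `s`. -/
def embedDiag (p₁ p₂ : ℕ) (s : Fin (min p₁ p₂) → ℝ) : Matrix (Fin p₁) (Fin p₂) ℝ :=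
  fun i j => if h : (i : ℕ) = (j : ℕ) ∧ (i : ℕ) < min p₁ p₂ then s ⟨i, h.2⟩ else 0


abbrev cL (p₁ p₂ : ℕ) (k : Fin (min p₁ p₂)) : Fin p₁ := Fin.castLE (min_le_left p₁ p₂) k
abbrev cR (p₁ p₂ : ℕ) (k : Fin (min p₁ p₂)) : Fin p₂ := Fin.castLE (min_le_right p₁ p₂) k

lemma embedDiag_eq_sum (p₁ p₂ : ℕ) (s : Fin (min p₁ p₂) → ℝ) :
    embedDiag p₁ p₂ s = ∑ k, Matrix.single (cL p₁ p₂ k) (cR p₁ p₂ k) (s k) := by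
  ext i j
  rw [Matrix.sum_apply]
  unfold embedDiag
  split_ifs with h
  · rw [Finset.sum_eq_single ⟨i, h.2⟩]
    · rw [Matrix.single_apply, if_pos]
      constructor
      · ext; simp
      · ext; simp [h.1]
    · intro b _ hb
      rw [Matrix.single_apply, if_neg]
      rintro ⟨h1, h2⟩
      apply hb
      ext
      simp [← h1]
    · simp
  · symm
    apply Finset.sum_eq_zero
    intro k _
    rw [Matrix.single_apply, if_neg]
    rintro ⟨h1, h2⟩
    apply h
    subst h1 h2
    exact ⟨by simp, k.2⟩

lemma mul_embedDiag_mul (p₁ p₂ : ℕ) (s : Fin (min p₁ p₂) → ℝ) (A : Matrix (Fin p₁) (Fin p₁) ℝ)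
    (C : Matrix (Fin p₂) (Fin p₂) ℝ) (i : Fin p₁) (j : Fin p₂) :
    (A * embedDiag p₁ p₂ s * C) i j = ∑ l, A i (cL p₁ p₂ l) * s l * C (cR p₁ p₂ l) j := by
  rw [embedDiag_eq_sum, Matrix.mul_sum, Matrix.sum_mul, Matrix.sum_apply]
  apply Finset.sum_congr rfl
  intro l _
  rw [← mul_one (s l), ← smul_eq_mul, ← Matrix.smul_single, Matrix.mul_assoc, Matrix.smul_mul,
    Matrix.mul_smul, Matrix.smul_apply, Matrix.mul_apply]
  rw [Finset.sum_eq_single (cL p₁ p₂ l)]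
  · simp
    ring
  · intro b _ hb
    simp [Matrix.single_mul_apply_of_ne _ _ _ _ _ hb]
  · simp

lemma trace_embedDiag (p₁ p₂ : ℕ) (g : Fin (min p₁ p₂) → ℝ) (X : Matrix (Fin p₁) (Fin p₂) ℝ) :
    trace ((embedDiag p₁ p₂ g)ᵀ * X) = ∑ k, g k * X (cL p₁ p₂ k) (cR p₁ p₂ k) := by
  rw [embedDiag_eq_sum, Matrix.transpose_sum, Matrix.sum_mul, Matrix.trace_sum]
  apply Finset.sum_congr rfl
  intro k _
  rw [Matrix.transpose_single, Matrix.trace_single_mul]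
  simp

lemma trace_conj {p₁ p₂ : ℕ} (U : Matrix (Fin p₁) (Fin p₁) ℝ) (V : Matrix (Fin p₂) (Fin p₂) ℝ)
    (E X : Matrix (Fin p₁) (Fin p₂) ℝ) :
    trace ((U * E * Vᵀ)ᵀ * X) = trace (Eᵀ * (Uᵀ * X * V)) := by
  rw [Matrix.transpose_mul, Matrix.transpose_mul, Matrix.transpose_transpose, Matrix.mul_assoc,
    Matrix.trace_mul_comm]
  simp only [Matrix.mul_assoc]

lemma orth_doublyStochastic {n : ℕ} (A : Matrix (Fin n) (Fin n) ℝ) (h1 : A * Aᵀ = 1)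
    (h2 : Aᵀ * A = 1) : (Matrix.of fun i j => A i j ^ 2) ∈ doublyStochastic ℝ (Fin n) := by
  rw [mem_doublyStochastic_iff_sum]
  refine ⟨fun i j => sq_nonneg _, fun i => ?_, fun j => ?_⟩
  · have := congrFun (congrFun h1 i) i
    simpa [Matrix.mul_apply, sq] using this
  · have := congrFun (congrFun h2 j) j
    simpa [Matrix.mul_apply, sq] using this

lemma ds_bound {n m : ℕ} (D : Matrix (Fin n) (Fin n) ℝ) (hD : D ∈ doublyStochastic ℝ (Fin n))
    (c : Fin m ↪ Fin n) (a b : Fin m → ℝ) (ha : ∀ i, 0 ≤ a i) (hb : ∀ i, 0 ≤ b i)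
    (e : Equiv.Perm (Fin m)) (hm : Monovary a (b ∘ e)) :
    ∑ k, ∑ l, a k * b l * D (c k) (c l) ≤ ∑ k, a k * b (e k) := by
  classical
  set a' : Fin n → ℝ := Function.extend c a 0 with ha'
  set b' : Fin n → ℝ := Function.extend c b 0 with hb'
  set e' := e.viaEmbedding c with he'
  have ea : ∀ k, a' (c k) = a k := fun k => c.injective.extend_apply _ _ _
  have eb : ∀ k, b' (c k) = b k := fun k => c.injective.extend_apply _ _ _
  have ea0 : ∀ i, i ∉ Set.range c → a' i = 0 := fun i hi => Function.extend_apply' _ _ _ hi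
  have eb0 : ∀ i, i ∉ Set.range c → b' i = 0 := fun i hi => Function.extend_apply' _ _ _ hi
  have ee : ∀ k, e' (c k) = c (e k) := fun k => e.viaEmbedding_apply c k
  have ee0 : ∀ i, i ∉ Set.range c → e' i = i := fun i hi => e.viaEmbedding_apply_of_notMem c i hi
  have hsum : ∀ F : Fin n → ℝ, (∀ i, i ∉ Set.range c → F i = 0) → ∑ k, F (c k) = ∑ i, F i := by
    intro F hF
    rw [← Finset.sum_map Finset.univ c F]
    apply Finset.sum_subset (Finset.subset_univ _)
    intro i _ hi
    apply hF
    simpa using hi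
  have hmono : Monovary a' (b' ∘ e') := by
    intro i j hij
    simp only [Function.comp] at hij
    by_cases hj : j ∈ Set.range c
    · obtain ⟨j, rfl⟩ := hj
      by_cases hi : i ∈ Set.range c
      · obtain ⟨i, rfl⟩ := hi
        rw [ee, ee, eb, eb] at hij
        rw [ea, ea]
        exact hm hij
      · rw [ea0 i hi, ea]; exact ha j
    · rw [ee0 j hj, eb0 j hj] at hij
      exfalso
      by_cases hi : i ∈ Set.range c
      · obtain ⟨i, rfl⟩ := hi
        rw [ee, eb] at hij
        linarith [hb (e i)]
      · rw [ee0 i hi, eb0 i hi] at hij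
        exact lt_irrefl _ hij
  obtain ⟨w, w0, w1, rfl⟩ := exists_eq_sum_perm_of_mem_doublyStochastic hD
  have hperm : ∀ τ : Equiv.Perm (Fin n), ∑ i, a' i * b' (τ i) ≤ ∑ i, a' i * b' (e' i) := by
    intro τ
    have := hmono.sum_mul_comp_perm_le_sum_mul (σ := τ.trans e'.symm)
    simpa using this
  have h1 : ∑ k, ∑ l, a k * b l * (∑ τ : Equiv.Perm (Fin n), w τ • τ.permMatrix ℝ) (c k) (c l)
      = ∑ τ : Equiv.Perm (Fin n), w τ * ∑ i, a' i * b' (τ i) := by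
    have : ∀ k l, a k * b l * (∑ τ : Equiv.Perm (Fin n), w τ • τ.permMatrix ℝ) (c k) (c l) =
       (fun i j => a' i * b' j * (∑ τ : Equiv.Perm (Fin n), w τ • τ.permMatrix ℝ) i j) (c k) (c l) := by
      intro k l
      simp only [ea, eb]
    simp only [this]
    have h3 : ∀ i, ∑ l, (fun i j => a' i * b' j * (∑ τ : Equiv.Perm (Fin n), w τ • τ.permMatrix ℝ) i j) i (c l)
       = ∑ j, (fun i j => a' i * b' j * (∑ τ : Equiv.Perm (Fin n), w τ • τ.permMatrix ℝ) i j) i j := by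
      intro i
      exact hsum (fun j => (a' i * b' j * (∑ τ : Equiv.Perm (Fin n), w τ • τ.permMatrix ℝ) i j)) (by intro j hj; simp [eb0 j hj])
    simp only [h3]
    rw [hsum (fun i => ∑ j, a' i * b' j * (∑ τ : Equiv.Perm (Fin n), w τ • τ.permMatrix ℝ) i j) (by intro j hj; simp [ea0 j hj])]
    simp only [Matrix.sum_apply, Finset.mul_sum, Matrix.smul_apply]
    have : ∀ i, ∑ j, ∑ τ : Equiv.Perm (Fin n), a' i * b' j * (w τ • τ.permMatrix ℝ i j) = ∑ τ : Equiv.Perm (Fin n), w τ * (a' i * b' (τ i)) := by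
      intro i
      rw [Finset.sum_comm]
      apply Finset.sum_congr rfl
      intro τ _
      rw [Finset.sum_eq_single (τ i)]
      · simp [Equiv.Perm.permMatrix, PEquiv.toMatrix_apply]; ring
      · intro j _ hj
        simp [Equiv.Perm.permMatrix, PEquiv.toMatrix_apply, hj.symm]
      · simp
    simp only [this]
    rw [Finset.sum_comm]
  rw [h1]
  calc _ ≤ ∑ τ : Equiv.Perm (Fin n), w τ * ∑ i, a' i * b' (e' i) :=
        Finset.sum_le_sum fun τ _ => mul_le_mul_of_nonneg_left (hperm τ) (w0 τ)
    _ = ∑ i, a' i * b' (e' i) := by rw [← Finset.sum_mul, w1, one_mul]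
    _ = _ := by
      rw [← hsum (fun i => a' i * b' (e' i)) (by intro j hj; simp [ea0 j hj])]
      simp only [ea, ee, eb]

lemma exists_monovary {m : ℕ} (a b : Fin m → ℝ) :
    ∃ e : Equiv.Perm (Fin m), Monovary a (b ∘ e) := by
  refine ⟨(Tuple.sort a).symm.trans (Tuple.sort b), ?_⟩
  intro i j hij
  have ma := Tuple.monotone_sort a
  have mb := Tuple.monotone_sort b
  simp only [Function.comp, Equiv.trans_apply] at hij
  have : (Tuple.sort a).symm i ≤ (Tuple.sort a).symm j := by
    by_contra hc
    push Not at hc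
    have := mb hc.le
    simp only [Function.comp] at this
    linarith
  simpa using ma this

/-- predicate: `(P, s, Q)` is an SVD of `M` (no order or sign constraints). -/
structure IsSVD {p₁ p₂ : ℕ} (M : Matrix (Fin p₁) (Fin p₂) ℝ) (P : Matrix (Fin p₁) (Fin p₁) ℝ)
    (s : Fin (min p₁ p₂) → ℝ) (Q : Matrix (Fin p₂) (Fin p₂) ℝ) : Prop where
  hP : P * Pᵀ = 1
  hP' : Pᵀ * P = 1
  hQ : Q * Qᵀ = 1
  hQ' : Qᵀ * Q = 1
  eq : M = P * embedDiag p₁ p₂ s * Qᵀ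

lemma IsSVD.conj {p₁ p₂ : ℕ} {M : Matrix (Fin p₁) (Fin p₂) ℝ} {P : Matrix (Fin p₁) (Fin p₁) ℝ}
    {s : Fin (min p₁ p₂) → ℝ} {Q : Matrix (Fin p₂) (Fin p₂) ℝ} (h : IsSVD M P s Q) :
    Pᵀ * M * Q = embedDiag p₁ p₂ s := by
  rw [h.eq]
  calc _ = (Pᵀ * P) * embedDiag p₁ p₂ s * (Qᵀ * Q) := by simp only [Matrix.mul_assoc]
    _ = _ := by rw [h.hP', h.hQ']; simp

lemma embedDiag_diag (p₁ p₂ : ℕ) (s : Fin (min p₁ p₂) → ℝ) (k : Fin (min p₁ p₂)) :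
    embedDiag p₁ p₂ s (cL p₁ p₂ k) (cR p₁ p₂ k) = s k := by
  unfold embedDiag
  rw [dif_pos ⟨by simp, k.2⟩]
  simp

/-- von Neumann type trace inequality. -/
lemma vonNeumann {p₁ p₂ : ℕ} {M : Matrix (Fin p₁) (Fin p₂) ℝ} {P : Matrix (Fin p₁) (Fin p₁) ℝ}
    {s : Fin (min p₁ p₂) → ℝ} {Q : Matrix (Fin p₂) (Fin p₂) ℝ} (h : IsSVD M P s Q)
    (U : Matrix (Fin p₁) (Fin p₁) ℝ) (V : Matrix (Fin p₂) (Fin p₂) ℝ)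
    (hU : U * Uᵀ = 1) (hU' : Uᵀ * U = 1) (hV : V * Vᵀ = 1) (hV' : Vᵀ * V = 1)
    (g : Fin (min p₁ p₂) → ℝ) :
    ∃ (e : Equiv.Perm (Fin (min p₁ p₂))) (ε : Fin (min p₁ p₂) → ℝ),
      (∀ i, ε i = 1 ∨ ε i = -1) ∧
      trace ((U * embedDiag p₁ p₂ g * Vᵀ)ᵀ * M) ≤ ∑ k, g k * (ε k * s (e k)) := by
  obtain ⟨e, he⟩ := exists_monovary (fun k => |g k|) (fun k => |s k|)
  refine ⟨e, fun k => if 0 ≤ g k * s (e k) then 1 else -1, fun i => ?_, ?_⟩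
  · simp only; split_ifs <;> simp
  have hr : ∀ k, g k * ((if 0 ≤ g k * s (e k) then (1:ℝ) else -1) * s (e k)) = |g k| * |s (e k)| := by
    intro k
    rw [← abs_mul]
    split_ifs with hk
    · rw [abs_of_nonneg hk]; ring
    · rw [abs_of_neg (not_le.1 hk)]; ring
  simp only [hr]
  set A := Uᵀ * P with hA
  set C := Vᵀ * Q with hC
  have hA1 : A * Aᵀ = 1 := by
    rw [hA, Matrix.transpose_mul, Matrix.transpose_transpose]
    calc _ = Uᵀ * (P * Pᵀ) * U := by simp only [Matrix.mul_assoc]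
      _ = 1 := by rw [h.hP]; simp [hU']
  have hC1 : C * Cᵀ = 1 := by
    rw [hC, Matrix.transpose_mul, Matrix.transpose_transpose]
    calc _ = Vᵀ * (Q * Qᵀ) * V := by simp only [Matrix.mul_assoc]
      _ = 1 := by rw [h.hQ]; simp [hV']
  have hA2 := mul_eq_one_comm.1 hA1
  have hC2 := mul_eq_one_comm.1 hC1
  have b1 := ds_bound _ (orth_doublyStochastic A hA1 hA2)
    ⟨cL p₁ p₂, Fin.castLE_injective _⟩ (fun k => |g k|) (fun k => |s k|)
    (fun _ => abs_nonneg _) (fun _ => abs_nonneg _) e he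
  have b2 := ds_bound _ (orth_doublyStochastic C hC1 hC2)
    ⟨cR p₁ p₂, Fin.castLE_injective _⟩ (fun k => |g k|) (fun k => |s k|)
    (fun _ => abs_nonneg _) (fun _ => abs_nonneg _) e he
  simp only [Function.Embedding.coeFn_mk, Matrix.of_apply] at b1 b2
  rw [trace_conj, trace_embedDiag]
  have hM : Uᵀ * M * V = A * embedDiag p₁ p₂ s * Cᵀ := by
    rw [h.eq, hA, hC, Matrix.transpose_mul, Matrix.transpose_transpose]
    simp only [Matrix.mul_assoc]
  rw [hM]
  simp only [mul_embedDiag_mul, Matrix.transpose_apply]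
  have key : ∑ k, g k * ∑ l, A (cL p₁ p₂ k) (cL p₁ p₂ l) * s l * C (cR p₁ p₂ k) (cR p₁ p₂ l)
     ≤ ∑ k, ∑ l, (|g k| * |s l| * A (cL p₁ p₂ k) (cL p₁ p₂ l) ^ 2 / 2 +
       |g k| * |s l| * C (cR p₁ p₂ k) (cR p₁ p₂ l) ^ 2 / 2) := by
    apply Finset.sum_le_sum
    intro k _
    rw [Finset.mul_sum]
    apply Finset.sum_le_sum
    intro l _
    generalize A (cL p₁ p₂ k) (cL p₁ p₂ l) = x
    generalize C (cR p₁ p₂ k) (cR p₁ p₂ l) = y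
    calc _ ≤ |g k * (x * s l * y)| := le_abs_self _
      _ = |g k| * |s l| * (|x| * |y|) := by simp only [abs_mul]; ring
      _ ≤ |g k| * |s l| * ((x^2 + y^2)/2) := by
        apply mul_le_mul_of_nonneg_left _ (by positivity)
        nlinarith [sq_nonneg (|x| - |y|), sq_abs x, sq_abs y]
      _ = _ := by ring
  simp only [Finset.sum_add_distrib, ← Finset.sum_div] at key
  linarith

lemma onb_orth {n : ℕ} (b : OrthonormalBasis (Fin n) ℝ (EuclideanSpace ℝ (Fin n))) :
    (Matrix.of fun i k => b k i)ᵀ * (Matrix.of fun i k => b k i) = (1 : Matrix (Fin n) (Fin n) ℝ) := by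
  ext k l
  have := orthonormal_iff_ite.1 b.orthonormal k l
  rw [PiLp.inner_apply] at this
  simp only [Matrix.mul_apply, Matrix.transpose_apply, Matrix.of_apply, Matrix.one_apply]
  rw [← this]
  apply Finset.sum_congr rfl
  intro i _
  simp [mul_comm]

lemma exists_svd_tall {p₁ p₂ : ℕ} (hp : p₂ ≤ p₁) (M : Matrix (Fin p₁) (Fin p₂) ℝ) :
    ∃ P s Q, IsSVD M P s Q := by
  classical
  have hN : (Mᵀ * M).IsHermitian := by
    simpa [Matrix.conjTranspose_eq_transpose_of_trivial] using Matrix.isHermitian_conjTranspose_mul_self M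
  set b := hN.eigenvectorBasis with hb
  set lam := hN.eigenvalues with hlam
  set w : Fin p₂ → EuclideanSpace ℝ (Fin p₁) := fun j => WithLp.toLp 2 (M *ᵥ (b j).ofLp) with hw
  have hinner : ∀ i j, inner ℝ (w i) (w j) = if i = j then lam j else 0 := by
    intro i j
    have h1 : inner ℝ (w i) (w j) = lam j * inner ℝ (b i) (b j) := by
      have e1 : inner ℝ (w i) (w j) = (M *ᵥ (b i).ofLp) ⬝ᵥ (M *ᵥ (b j).ofLp) := by
        simp [hw, PiLp.inner_apply, dotProduct, mul_comm]
      have e2 : inner ℝ (b i) (b j) = (b i).ofLp ⬝ᵥ (b j).ofLp := by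
        simp [PiLp.inner_apply, dotProduct, mul_comm]
      rw [e1, e2, Matrix.dotProduct_mulVec, Matrix.vecMul_mulVec, ← Matrix.dotProduct_mulVec,
        hN.mulVec_eigenvectorBasis j, dotProduct_smul, smul_eq_mul]
    rw [h1, orthonormal_iff_ite.1 b.orthonormal i j]
    simp
  have hlam0 : ∀ j, 0 ≤ lam j := by
    intro j
    have := hinner j j
    rw [if_pos rfl] at this
    rw [← this]
    exact real_inner_self_nonneg
  set v : Fin p₁ → EuclideanSpace ℝ (Fin p₁) :=
    fun i => if h : (i : ℕ) < p₂ then (Real.sqrt (lam ⟨i, h⟩))⁻¹ • w ⟨i, h⟩ else 0 with hv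
  set S : Set (Fin p₁) := {i | ∃ h : (i : ℕ) < p₂, lam ⟨i, h⟩ ≠ 0} with hS
  have horth : Orthonormal ℝ (S.domRestrict v) := by
    rw [orthonormal_iff_ite]
    rintro ⟨i, hi, hi0⟩ ⟨j, hj, hj0⟩
    simp only [Set.domRestrict_apply, hv, dif_pos hi, dif_pos hj, inner_smul_left, inner_smul_right, hinner]
    by_cases hij : i = j
    · subst hij
      have h0 : 0 < lam ⟨i, hi⟩ := lt_of_le_of_ne (hlam0 _) (Ne.symm hi0)
      have := Real.mul_self_sqrt h0.le
      have h2 : Real.sqrt (lam ⟨i, hi⟩) ≠ 0 := (Real.sqrt_pos.2 h0).ne'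
      simp
      field_simp
      rw [sq, this]
    · have : ¬ ((i : ℕ) = j) := fun h => hij (Fin.ext h)
      simp [hij, this]
  obtain ⟨u, hu⟩ := horth.exists_orthonormalBasis_extension_of_card_eq (by simp)
  refine ⟨Matrix.of fun i k => u k i, fun l => Real.sqrt (lam (cR p₁ p₂ l)), Matrix.of fun i k => b k i, ?_⟩
  have oU := onb_orth u
  have oV := onb_orth b
  refine ⟨mul_eq_one_comm.1 oU, oU, mul_eq_one_comm.1 oV, oV, ?_⟩
  have oV' := mul_eq_one_comm.1 oV
  set V : Matrix (Fin p₂) (Fin p₂) ℝ := Matrix.of fun i k => b k i with hV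
  set U : Matrix (Fin p₁) (Fin p₁) ℝ := Matrix.of fun i k => u k i with hU
  suffices h : M * V = U * embedDiag p₁ p₂ (fun l => Real.sqrt (lam (cR p₁ p₂ l))) by
    rw [← h, Matrix.mul_assoc, oV', Matrix.mul_one]
  ext i j
  have hMV : (M * V) i j = w j i := by
    simp [hw, hV, Matrix.mul_apply, Matrix.mulVec, dotProduct]
  rw [hMV, ← Matrix.mul_one (U * _), mul_embedDiag_mul]
  have hj : (j : ℕ) < min p₁ p₂ := by have := j.2; omega
  rw [Finset.sum_eq_single ⟨j, hj⟩]
  · have hcR : cR p₁ p₂ ⟨j, hj⟩ = j := by ext; simp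
    rw [hcR, Matrix.one_apply_eq, mul_one]
    have hself := hinner j j
    rw [if_pos rfl] at hself
    by_cases h0 : lam j = 0
    · rw [h0] at hself ⊢
      have := inner_self_eq_zero.1 hself
      rw [this]
      simp
    · have h0' : 0 < lam j := lt_of_le_of_ne (hlam0 _) (Ne.symm h0)
      have h2 : Real.sqrt (lam j) ≠ 0 := (Real.sqrt_pos.2 h0').ne'
      have hmem : cL p₁ p₂ ⟨j, hj⟩ ∈ S := ⟨j.2, h0⟩
      have := hu _ hmem
      simp only [hU, Matrix.of_apply]
      rw [this]
      simp only [hv]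
      rw [dif_pos (show ((cL p₁ p₂ ⟨j, hj⟩ : Fin p₁) : ℕ) < p₂ from j.2)]
      have : (⟨((cL p₁ p₂ ⟨j, hj⟩ : Fin p₁) : ℕ), j.2⟩ : Fin p₂) = j := by ext; simp
      simp only [this]
      simp
      field_simp
  · intro l _ hl
    rw [Matrix.one_apply_ne, mul_zero]
    intro h
    apply hl
    ext
    simp [← h]
  · simp

lemma embedDiag_transpose (p₁ p₂ : ℕ) (s : Fin (min p₂ p₁) → ℝ) :
    (embedDiag p₂ p₁ s)ᵀ = embedDiag p₁ p₂ (fun k => s (Fin.cast (min_comm p₁ p₂) k)) := by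
  ext i j
  simp only [Matrix.transpose_apply, embedDiag]
  by_cases h : (i : ℕ) = j ∧ (i : ℕ) < min p₁ p₂
  · have h' : (j : ℕ) = i ∧ (j : ℕ) < min p₂ p₁ := ⟨h.1.symm, by have := h.1; have := h.2; omega⟩
    rw [dif_pos h, dif_pos h']
    congr 1
    ext
    simp [h.1]
  · have h' : ¬ ((j : ℕ) = i ∧ (j : ℕ) < min p₂ p₁) := fun hh =>
      h ⟨hh.1.symm, by have := hh.1; have := hh.2; omega⟩
    rw [dif_neg h, dif_neg h']

lemma exists_svd {p₁ p₂ : ℕ} (M : Matrix (Fin p₁) (Fin p₂) ℝ) : ∃ P s Q, IsSVD M P s Q := by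
  rcases le_total p₂ p₁ with hp | hp
  · exact exists_svd_tall hp M
  · obtain ⟨P, s, Q, h⟩ := exists_svd_tall hp Mᵀ
    refine ⟨Q, fun k => s (Fin.cast (min_comm p₁ p₂) k), P, h.hQ, h.hQ', h.hP, h.hP', ?_⟩
    · rw [← embedDiag_transpose, ← Matrix.transpose_transpose M, h.eq]
      simp only [Matrix.transpose_mul, Matrix.transpose_transpose, Matrix.mul_assoc]

lemma convex_subgrad {m : ℕ} {f : (Fin m → ℝ) → ℝ} (hconv : ConvexOn ℝ Set.univ f)
    (hdiff : Differentiable ℝ f) (x v : Fin m → ℝ) :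
    fderiv ℝ f x v ≤ f (x + v) - f x := by
  have h1 : HasDerivAt (fun t : ℝ => f (x + t • v)) (fderiv ℝ f x v) 0 := by
    have h0 : HasFDerivAt f (fderiv ℝ f x) (x + (0:ℝ) • v) := by
      simpa using (hdiff x).hasFDerivAt
    have h2 : HasDerivAt (fun t : ℝ => x + t • v) v 0 := by
      simpa using ((hasDerivAt_id (0:ℝ)).smul_const v).const_add x
    exact h0.comp_hasDerivAt (0:ℝ) h2
  have hc : ConvexOn ℝ Set.univ (fun t : ℝ => f (x + t • v)) := by
    refine ⟨convex_univ, ?_⟩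
    intro a _ b _ p q hp hq hpq
    have := hconv.2 (Set.mem_univ (x + a • v)) (Set.mem_univ (x + b • v)) hp hq hpq
    refine le_trans (le_of_eq ?_) this
    simp only
    congr 1
    have : x = (p + q) • x := by rw [hpq, one_smul]
    nth_rewrite 1 [this]
    simp only [smul_add, add_smul, smul_smul, smul_eq_mul]
    abel
  have := hc.le_slope_of_hasDerivAt (Set.mem_univ 0) (Set.mem_univ 1) one_pos h1
  simpa [slope_def_field] using this

lemma convex_fderiv_upper {m : ℕ} {f : (Fin m → ℝ) → ℝ} (hconv : ConvexOn ℝ Set.univ f)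
    (hdiff : Differentiable ℝ f) (x v : Fin m → ℝ) (c : ℝ) (hc : fderiv ℝ f x v < c) :
    ∀ᶠ y in nhds x, fderiv ℝ f y v < c := by
  have h1 : HasDerivAt (fun t : ℝ => f (x + t • v)) (fderiv ℝ f x v) 0 := by
    have h0 : HasFDerivAt f (fderiv ℝ f x) (x + (0:ℝ) • v) := by
      simpa using (hdiff x).hasFDerivAt
    have h2 : HasDerivAt (fun t : ℝ => x + t • v) v 0 := by
      simpa using ((hasDerivAt_id (0:ℝ)).smul_const v).const_add x
    exact h0.comp_hasDerivAt (0:ℝ) h2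
  have h2 := h1.tendsto_slope_zero_right
  have h3 := (h2.eventually (gt_mem_nhds hc)).and self_mem_nhdsWithin
  obtain ⟨t, ht, ht0⟩ := h3.exists
  have ht0 : 0 < t := ht0
  have hcont : Continuous (fun y : Fin m → ℝ => t⁻¹ * (f (y + t • v) - f y)) := by
    have := hdiff.continuous
    fun_prop
  have := hcont.continuousAt.eventually (Iio_mem_nhds (show t⁻¹ * (f (x + t • v) - f x) < c by simpa using ht))
  filter_upwards [this] with y hy
  have hy : t⁻¹ * (f (y + t • v) - f y) < c := hy
  refine lt_of_le_of_lt ?_ hy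
  have := convex_subgrad hconv hdiff y (t • v)
  rw [map_smul, smul_eq_mul] at this
  rw [inv_mul_eq_div, le_div_iff₀ ht0]
  linarith

lemma convex_fderiv_cont {m : ℕ} {f : (Fin m → ℝ) → ℝ} (hconv : ConvexOn ℝ Set.univ f)
    (hdiff : Differentiable ℝ f) (v : Fin m → ℝ) :
    Continuous fun y => fderiv ℝ f y v := by
  rw [continuous_iff_continuousAt]
  intro x
  refine tendsto_order.2 ⟨fun c hc => ?_, fun c hc => convex_fderiv_upper hconv hdiff x v c hc⟩
  have := convex_fderiv_upper hconv hdiff x (-v) (-c) (by rw [map_neg]; linarith)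
  filter_upwards [this] with y hy
  rw [map_neg] at hy
  linarith

lemma clm_pi_sum {m : ℕ} (L : (Fin m → ℝ) →L[ℝ] ℝ) (v : Fin m → ℝ) :
    L v = ∑ k, L (Pi.single k 1) * v k := by
  conv_lhs => rw [pi_eq_sum_univ' v]
  rw [map_sum]
  apply Finset.sum_congr rfl
  intro k _
  rw [map_smul, smul_eq_mul, mul_comm]

/-- the candidate gradient -/
noncomputable def gradMat {p₁ p₂ : ℕ} (f : (Fin (min p₁ p₂) → ℝ) → ℝ)
    (P : Matrix (Fin p₁) (Fin p₁) ℝ) (s : Fin (min p₁ p₂) → ℝ) (Q : Matrix (Fin p₂) (Fin p₂) ℝ) :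
    Matrix (Fin p₁) (Fin p₂) ℝ :=
  P * embedDiag p₁ p₂ (fun i => fderiv ℝ f s (Pi.single i 1)) * Qᵀ

section main
variable {p₁ p₂ : ℕ} {f : (Fin (min p₁ p₂) → ℝ) → ℝ}

lemma subgrad
    (hsym : ∀ (e : Equiv.Perm (Fin (min p₁ p₂))) (ε : Fin (min p₁ p₂) → ℝ),
      (∀ i, ε i = 1 ∨ ε i = -1) → ∀ s, f s = f fun i => ε i * s (e i))
    (hconv : ConvexOn ℝ Set.univ f) (hdiff : Differentiable ℝ f)
    {R : Matrix (Fin p₁) (Fin p₂) ℝ → ℝ} (hR : ∀ M U s V, IsSVD M U s V → R M = f s)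
    {B : Matrix (Fin p₁) (Fin p₂) ℝ} {U : Matrix (Fin p₁) (Fin p₁) ℝ}
    {V : Matrix (Fin p₂) (Fin p₂) ℝ} {σ : Fin (min p₁ p₂) → ℝ} (h : IsSVD B U σ V)
    (M : Matrix (Fin p₁) (Fin p₂) ℝ) :
    trace ((gradMat f U σ V)ᵀ * (M - B)) ≤ R M - R B := by
  obtain ⟨P, s, Q, hM⟩ := exists_svd M
  rw [hR _ _ _ _ hM, hR _ _ _ _ h, Matrix.mul_sub, Matrix.trace_sub]
  obtain ⟨e, ε, hε, hle⟩ := vonNeumann hM U V h.hP h.hP' h.hQ h.hQ'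
    (fun i => fderiv ℝ f σ (Pi.single i 1))
  have h2 : trace ((gradMat f U σ V)ᵀ * B) = ∑ k, fderiv ℝ f σ (Pi.single k 1) * σ k := by
    rw [gradMat, trace_conj, trace_embedDiag, h.conj]
    simp only [embedDiag_diag]
  have h3 := convex_subgrad hconv hdiff σ ((fun k => ε k * s (e k)) - σ)
  rw [clm_pi_sum] at h3
  simp only [add_sub_cancel, ← hsym e ε hε s, Pi.sub_apply, mul_sub, Finset.sum_sub_distrib] at h3
  rw [h2]
  unfold gradMat
  linarith

lemma diag_of_subgrad (hdiff : Differentiable ℝ f)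
    {R : Matrix (Fin p₁) (Fin p₂) ℝ → ℝ} (hR : ∀ M U s V, IsSVD M U s V → R M = f s)
    {B G : Matrix (Fin p₁) (Fin p₂) ℝ}
    (hG : ∀ M, trace (Gᵀ * (M - B)) ≤ R M - R B) {P : Matrix (Fin p₁) (Fin p₁) ℝ}
    {Q : Matrix (Fin p₂) (Fin p₂) ℝ} {s : Fin (min p₁ p₂) → ℝ} (h : IsSVD B P s Q)
    (k : Fin (min p₁ p₂)) :
    (Pᵀ * G * Q) (cL p₁ p₂ k) (cR p₁ p₂ k) = fderiv ℝ f s (Pi.single k 1) := by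
  set d : Fin (min p₁ p₂) → ℝ := fun k => (Pᵀ * G * Q) (cL p₁ p₂ k) (cR p₁ p₂ k) with hd
  have htr : ∀ x, trace (Gᵀ * (P * embedDiag p₁ p₂ x * Qᵀ)) = ∑ k, x k * d k := by
    intro x
    rw [← Matrix.trace_transpose, Matrix.transpose_mul, Matrix.transpose_transpose, trace_conj,
      trace_embedDiag]
  let L : (Fin (min p₁ p₂) → ℝ) →L[ℝ] ℝ := ∑ k, d k • ContinuousLinearMap.proj k
  have hL : ∀ x, L x = ∑ k, x k * d k := by
    intro x
    simp [L, mul_comm]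
  have hmin : IsLocalMin (fun x => f x - L x) s := by
    apply Filter.Eventually.of_forall
    intro x
    have h1 := hG (P * embedDiag p₁ p₂ x * Qᵀ)
    rw [hR _ P x Q ⟨h.hP, h.hP', h.hQ, h.hQ', rfl⟩, hR _ _ _ _ h, Matrix.mul_sub,
      Matrix.trace_sub, htr] at h1
    rw [h.eq, htr, ← hL, ← hL] at h1
    simp only
    linarith
  have h0 := hmin.hasFDerivAt_eq_zero ((hdiff s).hasFDerivAt.sub L.hasFDerivAt)
  have h1 := congrArg (fun T : (Fin (min p₁ p₂) → ℝ) →L[ℝ] ℝ => T (Pi.single k 1)) h0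
  simp only [_root_.sub_apply, _root_.zero_apply, hL] at h1
  have h2 : ∑ j, (Pi.single k 1 : Fin (min p₁ p₂) → ℝ) j * d j = d k := by
    rw [Finset.sum_eq_single k]
    · simp
    · intro b _ hb; simp [hb]
    · simp
  rw [h2] at h1
  linarith

lemma trace_self_zero {X : Matrix (Fin p₁) (Fin p₂) ℝ} (h : trace (Xᵀ * X) = 0) : X = 0 := by
  rw [← Matrix.conjTranspose_eq_transpose_of_trivial] at h
  exact Matrix.trace_conjTranspose_mul_self_eq_zero_iff.1 h

lemma grad_unique
    (hsym : ∀ (e : Equiv.Perm (Fin (min p₁ p₂))) (ε : Fin (min p₁ p₂) → ℝ),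
      (∀ i, ε i = 1 ∨ ε i = -1) → ∀ s, f s = f fun i => ε i * s (e i))
    (hconv : ConvexOn ℝ Set.univ f) (hdiff : Differentiable ℝ f)
    {R : Matrix (Fin p₁) (Fin p₂) ℝ → ℝ} (hR : ∀ M U s V, IsSVD M U s V → R M = f s)
    {B : Matrix (Fin p₁) (Fin p₂) ℝ} {U P : Matrix (Fin p₁) (Fin p₁) ℝ}
    {V Q : Matrix (Fin p₂) (Fin p₂) ℝ} {σ s : Fin (min p₁ p₂) → ℝ} (h : IsSVD B U σ V)
    (h' : IsSVD B P s Q) : gradMat f U σ V = gradMat f P s Q := by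
  have key : ∀ (U P : Matrix (Fin p₁) (Fin p₁) ℝ) (V Q : Matrix (Fin p₂) (Fin p₂) ℝ)
      (σ s : Fin (min p₁ p₂) → ℝ), IsSVD B U σ V → IsSVD B P s Q →
      trace ((gradMat f P s Q)ᵀ * gradMat f U σ V) =
        ∑ k, fderiv ℝ f s (Pi.single k 1) * fderiv ℝ f s (Pi.single k 1) := by
    intro U P V Q σ s h h'
    have hd := diag_of_subgrad hdiff hR (subgrad hsym hconv hdiff hR h) h'
    conv_lhs => rw [gradMat, trace_conj, trace_embedDiag]
    simp only [hd]
  have k1 := key U P V Q σ s h h'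
  have k2 := key P U Q V s σ h' h
  have k3 := key U U V V σ σ h h
  have k4 := key P P Q Q s s h' h'
  rw [← sub_eq_zero]
  apply trace_self_zero
  rw [Matrix.transpose_sub, Matrix.mul_sub, Matrix.sub_mul, Matrix.sub_mul]
  simp only [Matrix.trace_sub]
  linarith

lemma isCompact_orth (n : ℕ) :
    IsCompact {P : Matrix (Fin n) (Fin n) ℝ | P * Pᵀ = 1 ∧ Pᵀ * P = 1} := by
  apply Metric.isCompact_of_isClosed_isBounded
  · apply IsClosed.inter
    · exact isClosed_eq (by fun_prop) (by fun_prop)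
    · exact isClosed_eq (by fun_prop) (by fun_prop)
  · apply (Metric.isBounded_closedBall (x := 0) (r := 1)).subset
    rintro P ⟨h1, -⟩
    rw [mem_closedBall_zero_iff, Matrix.norm_le_iff zero_le_one]
    intro i j
    have := congrFun (congrFun h1 i) i
    simp only [Matrix.mul_apply, Matrix.transpose_apply, Matrix.one_apply_eq] at this
    have h2 : P i j * P i j ≤ 1 := by
      rw [← this]
      exact Finset.single_le_sum (f := fun j => P i j * P i j) (fun j _ => mul_self_nonneg _)
        (Finset.mem_univ j)
    rw [Real.norm_eq_abs]
    exact abs_le_one_iff_mul_self_le_one.2 h2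

lemma embedDiag_cont : Continuous (embedDiag p₁ p₂) := by
  refine continuous_matrix fun i j => ?_
  unfold embedDiag
  by_cases h : (i : ℕ) = (j : ℕ) ∧ (i : ℕ) < min p₁ p₂
  · simp only [dif_pos h]
    exact continuous_apply _
  · simp only [dif_neg h]
    exact continuous_const

lemma gradMat_cont (hconv : ConvexOn ℝ Set.univ f) (hdiff : Differentiable ℝ f) :
    Continuous fun x : Matrix (Fin p₁) (Fin p₁) ℝ × (Fin (min p₁ p₂) → ℝ) ×
      Matrix (Fin p₂) (Fin p₂) ℝ => gradMat f x.1 x.2.1 x.2.2 := by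
  unfold gradMat
  have h1 : Continuous fun s : Fin (min p₁ p₂) → ℝ =>
      embedDiag p₁ p₂ (fun i => fderiv ℝ f s (Pi.single i 1)) :=
    embedDiag_cont.comp (continuous_pi fun i => convex_fderiv_cont hconv hdiff _)
  have h2 := h1.comp (continuous_fst.comp (continuous_snd (X := Matrix (Fin p₁) (Fin p₁) ℝ)
    (Y := (Fin (min p₁ p₂) → ℝ) × Matrix (Fin p₂) (Fin p₂) ℝ)))
  exact (continuous_fst.matrix_mul h2).matrix_mul (continuous_snd.comp continuous_snd).matrix_transpose

lemma tendsto_three {X Y Z W ι : Type*} [TopologicalSpace X] [TopologicalSpace Y]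
    [TopologicalSpace Z] [TopologicalSpace W] {F : X × Y × Z → W} (hF : Continuous F)
    {l : Filter ι} {a : ι → X} {b : ι → Y} {c : ι → Z} {x : X} {y : Y} {z : Z}
    (ha : Filter.Tendsto a l (nhds x)) (hb : Filter.Tendsto b l (nhds y))
    (hc : Filter.Tendsto c l (nhds z)) :
    Filter.Tendsto (fun i => F (a i, b i, c i)) l (nhds (F (x, y, z))) :=
  (hF.tendsto (x, y, z)).comp (ha.prodMk_nhds (hb.prodMk_nhds hc))

lemma grad_tendsto
    (hsym : ∀ (e : Equiv.Perm (Fin (min p₁ p₂))) (ε : Fin (min p₁ p₂) → ℝ),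
      (∀ i, ε i = 1 ∨ ε i = -1) → ∀ s, f s = f fun i => ε i * s (e i))
    (hconv : ConvexOn ℝ Set.univ f) (hdiff : Differentiable ℝ f)
    {R : Matrix (Fin p₁) (Fin p₂) ℝ → ℝ} (hR : ∀ M U s V, IsSVD M U s V → R M = f s)
    {B : Matrix (Fin p₁) (Fin p₂) ℝ} {U : Matrix (Fin p₁) (Fin p₁) ℝ}
    {V : Matrix (Fin p₂) (Fin p₂) ℝ} {σ : Fin (min p₁ p₂) → ℝ} (h : IsSVD B U σ V)
    (P : Matrix (Fin p₁) (Fin p₂) ℝ → Matrix (Fin p₁) (Fin p₁) ℝ)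
    (s : Matrix (Fin p₁) (Fin p₂) ℝ → Fin (min p₁ p₂) → ℝ)
    (Q : Matrix (Fin p₁) (Fin p₂) ℝ → Matrix (Fin p₂) (Fin p₂) ℝ)
    (hM : ∀ M, IsSVD M (P M) (s M) (Q M)) :
    Filter.Tendsto (fun M => gradMat f (P M) (s M) (Q M)) (nhds B) (nhds (gradMat f U σ V)) := by
  rw [Filter.tendsto_iff_ultrafilter]
  intro 𝒰 h𝒰
  have hid : Filter.Tendsto (fun M : Matrix (Fin p₁) (Fin p₂) ℝ => M) 𝒰 (nhds B) := h𝒰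
  obtain ⟨P', hP', tP⟩ := (isCompact_orth p₁).ultrafilter_le_nhds (𝒰.map P)
    (by
      simp only [Filter.le_principal_iff]
      exact Filter.mem_map.2 (Filter.univ_mem' fun M => ⟨(hM M).hP, (hM M).hP'⟩))
  obtain ⟨Q', hQ', tQ⟩ := (isCompact_orth p₂).ultrafilter_le_nhds (𝒰.map Q)
    (by
      simp only [Filter.le_principal_iff]
      exact Filter.mem_map.2 (Filter.univ_mem' fun M => ⟨(hM M).hQ, (hM M).hQ'⟩))
  have tP : Filter.Tendsto P 𝒰 (nhds P') := tP
  have tQ : Filter.Tendsto Q 𝒰 (nhds Q') := tQ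
  have tE : Filter.Tendsto (fun M => (P M)ᵀ * M * Q M) 𝒰 (nhds (P'ᵀ * B * Q')) := by
    have hc : Continuous fun x : Matrix (Fin p₁) (Fin p₁) ℝ × Matrix (Fin p₁) (Fin p₂) ℝ ×
      Matrix (Fin p₂) (Fin p₂) ℝ => x.1ᵀ * x.2.1 * x.2.2 :=
      (continuous_fst.matrix_transpose.matrix_mul (continuous_fst.comp continuous_snd)).matrix_mul
        (continuous_snd.comp continuous_snd)
    exact tendsto_three hc tP hid tQ
  set s' : Fin (min p₁ p₂) → ℝ := fun k => (P'ᵀ * B * Q') (cL p₁ p₂ k) (cR p₁ p₂ k) with hs'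
  have ts : Filter.Tendsto s 𝒰 (nhds s') := by
    rw [tendsto_pi_nhds]
    intro k
    have hc : Continuous fun X : Matrix (Fin p₁) (Fin p₂) ℝ => X (cL p₁ p₂ k) (cR p₁ p₂ k) :=
      continuous_id.matrix_elem _ _
    have := (hc.tendsto _).comp tE
    refine this.congr fun M => ?_
    simp only [Function.comp]
    rw [(hM M).conj, embedDiag_diag]
  have hB' : IsSVD B P' s' Q' := by
    refine ⟨hP'.1, hP'.2, hQ'.1, hQ'.2, ?_⟩
    have hc : Continuous fun x : Matrix (Fin p₁) (Fin p₁) ℝ × (Fin (min p₁ p₂) → ℝ) ×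
      Matrix (Fin p₂) (Fin p₂) ℝ => x.1 * embedDiag p₁ p₂ x.2.1 * x.2.2ᵀ :=
      (continuous_fst.matrix_mul (embedDiag_cont.comp (continuous_fst.comp continuous_snd))).matrix_mul
        (continuous_snd.comp continuous_snd).matrix_transpose
    have := tendsto_three hc tP ts tQ
    refine tendsto_nhds_unique hid (this.congr fun M => ?_)
    exact (hM M).eq.symm
  rw [grad_unique hsym hconv hdiff hR h hB']
  exact tendsto_three (gradMat_cont hconv hdiff) tP ts tQ

lemma abs_trace_le (X Y : Matrix (Fin p₁) (Fin p₂) ℝ) :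
    |trace (Xᵀ * Y)| ≤ (p₂ * p₁ : ℝ) * ‖X‖ * ‖Y‖ := by
  simp only [Matrix.trace, Matrix.diag_apply, Matrix.mul_apply, Matrix.transpose_apply]
  calc _ ≤ ∑ j : Fin p₂, |∑ i : Fin p₁, X i j * Y i j| := Finset.abs_sum_le_sum_abs _ _
    _ ≤ ∑ j : Fin p₂, ∑ i : Fin p₁, |X i j * Y i j| :=
      Finset.sum_le_sum fun j _ => Finset.abs_sum_le_sum_abs _ _
    _ ≤ ∑ j : Fin p₂, ∑ i : Fin p₁, ‖X‖ * ‖Y‖ := by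
      refine Finset.sum_le_sum fun j _ => Finset.sum_le_sum fun i _ => ?_
      rw [abs_mul]
      exact mul_le_mul (X.norm_entry_le_entrywise_sup_norm) (Y.norm_entry_le_entrywise_sup_norm)
        (abs_nonneg _) (norm_nonneg _)
    _ = _ := by simp; ring

lemma main_hasFDerivAt
    (hsym : ∀ (e : Equiv.Perm (Fin (min p₁ p₂))) (ε : Fin (min p₁ p₂) → ℝ),
      (∀ i, ε i = 1 ∨ ε i = -1) → ∀ s, f s = f fun i => ε i * s (e i))
    (hconv : ConvexOn ℝ Set.univ f) (hdiff : Differentiable ℝ f)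
    {R : Matrix (Fin p₁) (Fin p₂) ℝ → ℝ} (hR : ∀ M U s V, IsSVD M U s V → R M = f s)
    {B : Matrix (Fin p₁) (Fin p₂) ℝ} {U : Matrix (Fin p₁) (Fin p₁) ℝ}
    {V : Matrix (Fin p₂) (Fin p₂) ℝ} {σ : Fin (min p₁ p₂) → ℝ} (h : IsSVD B U σ V)
    (L : Matrix (Fin p₁) (Fin p₂) ℝ →L[ℝ] ℝ)
    (hL : ∀ Δ, L Δ = trace ((gradMat f U σ V)ᵀ * Δ)) :
    HasFDerivAt R L B := by
  choose P s Q hM using fun M : Matrix (Fin p₁) (Fin p₂) ℝ => exists_svd M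
  have ht := grad_tendsto hsym hconv hdiff hR h P s Q hM
  apply HasFDerivAt.of_isLittleO
  rw [Asymptotics.isLittleO_iff]
  intro c hc
  have hpos : 0 < c / (p₂ * p₁ + 1 : ℝ) := by positivity
  have hev := Metric.tendsto_nhds.1 ht _ hpos
  filter_upwards [hev] with M hMd
  rw [dist_eq_norm] at hMd
  have lo := subgrad hsym hconv hdiff hR h M
  have up := subgrad hsym hconv hdiff hR (hM M) B
  have hb := abs_trace_le (gradMat f (P M) (s M) (Q M) - gradMat f U σ V) (M - B)
  have e1 : trace ((gradMat f (P M) (s M) (Q M))ᵀ * (B - M)) =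
      - trace ((gradMat f (P M) (s M) (Q M))ᵀ * (M - B)) := by
    rw [← neg_sub M B, Matrix.mul_neg, Matrix.trace_neg]
  rw [Matrix.transpose_sub, Matrix.sub_mul, Matrix.trace_sub] at hb
  have hb2 := le_of_abs_le hb
  have e2 : R M - R B - L (M - B) = R M - R B - trace ((gradMat f U σ V)ᵀ * (M - B)) := by rw [hL]
  refine le_trans (le_of_eq (congrArg norm e2)) ?_
  rw [Real.norm_eq_abs, abs_of_nonneg (by linarith)]
  refine le_trans (b := (p₂ * p₁ : ℝ) * ‖gradMat f (P M) (s M) (Q M) - gradMat f U σ V‖ * ‖M - B‖)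
    (by linarith) ?_
  apply mul_le_mul_of_nonneg_right _ (norm_nonneg _)
  rw [lt_div_iff₀ (by positivity)] at hMd
  nlinarith [norm_nonneg (gradMat f (P M) (s M) (Q M) - gradMat f U σ V)]

end main

/-- Lewis: a unitarily invariant function `R(B) = f(σ(B))` with `f`
absolutely symmetric, convex and differentiable is differentiable, and
`∇R(B) = U diag[∇f(σ)] Vᵀ` for any SVD `B = U diag[σ] Vᵀ` (the gradient taken with
respect to the Frobenius inner product). -/
theorem stmt17 (p₁ p₂ : ℕ) (f : (Fin (min p₁ p₂) → ℝ) → ℝ)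
    (hsym : ∀ (e : Equiv.Perm (Fin (min p₁ p₂))) (ε : Fin (min p₁ p₂) → ℝ),
      (∀ i, ε i = 1 ∨ ε i = -1) → ∀ s, f s = f fun i => ε i * s (e i))
    (hconv : ConvexOn ℝ Set.univ f) (hdiff : Differentiable ℝ f)
    (R : Matrix (Fin p₁) (Fin p₂) ℝ → ℝ)
    (hR : ∀ (M : Matrix (Fin p₁) (Fin p₂) ℝ) (U : Matrix (Fin p₁) (Fin p₁) ℝ)
        (V : Matrix (Fin p₂) (Fin p₂) ℝ) (s : Fin (min p₁ p₂) → ℝ),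
        U * Uᵀ = 1 → Uᵀ * U = 1 → V * Vᵀ = 1 → Vᵀ * V = 1 →
        M = U * embedDiag p₁ p₂ s * Vᵀ → R M = f s)
    (B : Matrix (Fin p₁) (Fin p₂) ℝ) (U : Matrix (Fin p₁) (Fin p₁) ℝ)
    (V : Matrix (Fin p₂) (Fin p₂) ℝ) (σ : Fin (min p₁ p₂) → ℝ)
    (hU : U * Uᵀ = 1) (hU' : Uᵀ * U = 1) (hV : V * Vᵀ = 1) (hV' : Vᵀ * V = 1)
    (hB : B = U * embedDiag p₁ p₂ σ * Vᵀ) :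
    DifferentiableAt ℝ R B ∧
      ∀ Δ : Matrix (Fin p₁) (Fin p₂) ℝ,
        fderiv ℝ R B Δ =
          Matrix.trace
            ((U * embedDiag p₁ p₂ (fun i => fderiv ℝ f σ (Pi.single i 1)) * Vᵀ)ᵀ * Δ) := by
  have hR' : ∀ M U s V, IsSVD M U s V → R M = f s :=
    fun M U s V h => hR M U V s h.hP h.hP' h.hQ h.hQ' h.eq
  have h : IsSVD B U σ V := ⟨hU, hU', hV, hV', hB⟩
  let L₀ : Matrix (Fin p₁) (Fin p₂) ℝ →ₗ[ℝ] ℝ :=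
    { toFun := fun Δ => trace ((gradMat f U σ V)ᵀ * Δ)
      map_add' := fun x y => by rw [Matrix.mul_add, Matrix.trace_add]
      map_smul' := fun c x => by rw [Matrix.mul_smul, Matrix.trace_smul]; rfl }
  have hF := main_hasFDerivAt hsym hconv hdiff hR' h (LinearMap.toContinuousLinearMap L₀)
    (fun Δ => rfl)
  refine ⟨hF.differentiableAt, fun Δ => ?_⟩
  rw [hF.fderiv]
  rfl
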